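/- arXiv:1705.02316 — 6 statements merged into one kernel-verified Lean document; each statement's English description precedes it below -/
import Mathlib

section
/- Let K be a quartic CM field with real quadratic subfield F, let φ₁, φ₂ : K → ℂ be non-conjugate embeddings, and let γ be an algebraic integer of K. Then there exists an integer m such that (Δ_F · φ₁(γ − γ̄) · φ₂(γ − γ̄))² = m² · Δ_K, as an identity of complex numbers. (Equivalently, φ₁(γ − γ̄)·φ₂(γ − γ̄) lies in (√Δ_K / Δ_F)·ℤ.) -/
/-- The discriminant of a family of algebraic integers, indexed by a basis of the ring of integers,
is the field discriminant times the square of an integer. -/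
theorem exists_discr_eq_sq_mul_discr {K ι : Type*} [Field K] [NumberField K] [Fintype ι]
    [DecidableEq ι] (B : Module.Basis ι ℤ (NumberField.RingOfIntegers K))
    (b : ι → NumberField.RingOfIntegers K) :
    ∃ m : ℤ, Algebra.discr ℤ b = m ^ 2 * NumberField.discr K := by
  refine ⟨(B.toMatrix b).det, ?_⟩
  have h := Algebra.discr_of_matrix_vecMul (A := ℤ) B (B.toMatrix b)
  rw [NumberField.discr_eq_discr K B] at h
  rw [← h]
  congr 1
  ext1 i
  rw [← B.sum_toMatrix_smul_self b i]
  simp [Matrix.vecMul, dotProduct, Algebra.smul_def, mul_comm]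

/-- The discriminant of a family of algebraic integers is the squared determinant of the matrix of
its conjugates, for any enumeration of the complex embeddings. -/
theorem intCast_discr_eq_det_sq {K ι : Type*} [Field K] [NumberField K] [Fintype ι]
    [DecidableEq ι] (hι : Fintype.card ι = Module.finrank ℚ K)
    (b : ι → NumberField.RingOfIntegers K) (v : ι → (K →+* ℂ)) (hv : Function.Injective v) :
    (Algebra.discr ℤ b : ℂ) = (Matrix.of fun i j => v j (b i : K)).det ^ 2 := by
  have hbij : Function.Bijective fun i => (v i).toRatAlgHom := by
    rw [Fintype.bijective_iff_injective_and_card, AlgHom.card]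
    exact ⟨fun i j hij => hv (RingHom.ext fun x => AlgHom.congr_fun hij x), hι⟩
  have h := Algebra.discr_eq_det_embeddingsMatrixReindex_pow_two ℚ ℂ (fun i => (b i : K))
    (Equiv.ofBijective _ hbij)
  have hd : Algebra.discr ℚ (fun i => (b i : K)) = (Algebra.discr ℤ b : ℤ) := by
    rw [Algebra.discr_def, Algebra.discr_def, Int.cast_det]
    congr 1
    ext i j
    simp only [Algebra.traceMatrix_apply, Algebra.traceForm_apply, Matrix.map_apply]
    rw [← map_mul, Algebra.coe_trace_int]
  rw [hd, map_intCast] at h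
  exact h

/-- Three embeddings of a field extension of degree two that agree on the base field are not
pairwise distinct. -/
theorem eq_or_eq_of_comp_eq {F K : Type*} [Field F] [CharZero F] [Field K] [Algebra F K]
    (h : Module.finrank F K = 2) {f g k : K →+* ℂ} (hfg : f ≠ g)
    (hg : ∀ x, g (algebraMap F K x) = f (algebraMap F K x))
    (hk : ∀ x, k (algebraMap F K x) = f (algebraMap F K x)) : k = f ∨ k = g := by
  let := (f.comp (algebraMap F K)).toAlgebra
  have : FiniteDimensional F K := Module.finite_of_finrank_pos (by omega)
  have hc : Fintype.card (K →ₐ[F] ℂ) = 2 := by rw [AlgHom.card, h]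
  let f' : K →ₐ[F] ℂ := { f with commutes' := fun x => rfl }
  let g' : K →ₐ[F] ℂ := { g with commutes' := hg }
  let k' : K →ₐ[F] ℂ := { k with commutes' := hk }
  by_contra! hne
  classical
  have h3 : ({f', g', k'} : Finset (K →ₐ[F] ℂ)).card = 3 := by
    refine Finset.card_eq_three.mpr ⟨f', g', k', ?_, ?_, ?_, rfl⟩ <;> intro heq
    · exact hfg (congrArg AlgHom.toRingHom heq)
    · exact hne.1 (congrArg AlgHom.toRingHom heq).symm
    · exact hne.2 (congrArg AlgHom.toRingHom heq).symm
  have := Finset.card_le_univ ({f', g', k'} : Finset (K →ₐ[F] ℂ))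
  omega

theorem stmt_6 (K F : Type*) [Field K] [NumberField K] [Field F] [NumberField F]
    (hK4 : Module.finrank ℚ K = 4) (hF2 : Module.finrank ℚ F = 2)
    (hFreal : ∀ (ψ : F →+* ℂ) (x : F), (ψ x).im = 0)
    (hKim : IsEmpty (K →+* ℝ))
    (ι : F →+* K)
    (σ : K ≃+* K)
    (hσ : ∀ (φ : K →+* ℂ) (x : K), φ (σ x) = starRingEnd ℂ (φ x))
    (hσF : ∀ y : F, σ (ι y) = ι y)
    (φ₁ φ₂ : K →+* ℂ)
    (hnc : φ₂ ≠ φ₁ ∧ φ₂ ≠ (starRingEnd ℂ).comp φ₁)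
    (γ : K) (hγ : IsIntegral ℤ γ) :
    ∃ m : ℤ, ((NumberField.discr F : ℂ) * φ₁ (γ - σ γ) * φ₂ (γ - σ γ)) ^ 2
      = (m : ℂ) ^ 2 * (NumberField.discr K : ℂ) := by
  have hne : ∀ φ : K →+* ℂ, φ ≠ (starRingEnd ℂ).comp φ := fun φ h =>
    hKim.elim (NumberField.ComplexEmbedding.IsReal.embedding (φ := φ) h.symm)
  have hφF : φ₁.comp ι ≠ φ₂.comp ι := by
    intro h
    let := ι.toAlgebra
    have hfin : Module.finrank F K = 2 := by
      have := Module.finrank_mul_finrank ℚ F K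
      rw [hK4, hF2] at this
      omega
    rcases eq_or_eq_of_comp_eq (F := F) hfin (hne φ₁)
      (fun x => by
        change starRingEnd ℂ (φ₁ (ι x)) = φ₁ (ι x)
        rw [← hσ, hσF]) (fun x => (RingHom.congr_fun h x).symm) with h' | h'
    · exact hnc.1 h'
    · exact hnc.2 h'
  let BF : Module.Basis (Fin 2) ℤ (NumberField.RingOfIntegers F) :=
    Module.finBasisOfFinrankEq _ _ (by rw [NumberField.RingOfIntegers.rank, hF2])
  let BK : Module.Basis (Fin 4) ℤ (NumberField.RingOfIntegers K) :=
    Module.finBasisOfFinrankEq _ _ (by rw [NumberField.RingOfIntegers.rank, hK4])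
  let w (i : Fin 2) : NumberField.RingOfIntegers K := NumberField.RingOfIntegers.mapRingHom ι (BF i)
  have hw (i : Fin 2) : (w i : K) = ι (BF i : F) := rfl
  let g : NumberField.RingOfIntegers K := ⟨γ, hγ⟩
  have hg : (g : K) = γ := rfl
  obtain ⟨m, hm⟩ := exists_discr_eq_sq_mul_discr BK ![w 0, w 1, g * w 0, g * w 1]
  have hcF := intCast_discr_eq_det_sq (by simp [hF2]) BF ![φ₁.comp ι, φ₂.comp ι] (by
    intro i j
    fin_cases i <;> fin_cases j <;> simp [hφF, hφF.symm])
  have hcK := intCast_discr_eq_det_sq (by simp [hK4]) ![w 0, w 1, g * w 0, g * w 1]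
    ![φ₁, φ₂, φ₁.comp σ.toRingHom, φ₂.comp σ.toRingHom] (by
      have h2 (φ : K →+* ℂ) : φ.comp σ.toRingHom = (starRingEnd ℂ).comp φ := RingHom.ext (hσ φ)
      have h4 : φ₁ ≠ (starRingEnd ℂ).comp φ₂ := fun h => hnc.2 (by
        rw [h]; ext x; simp)
      have h5 : (starRingEnd ℂ).comp φ₁ ≠ (starRingEnd ℂ).comp φ₂ := fun h => hnc.1 (by
        ext x; exact (star_injective (RingHom.congr_fun h x)).symm)
      rw [h2, h2]
      intro i j
      fin_cases i <;> fin_cases j <;>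
        simp [hnc.1, hnc.1.symm, hnc.2, hnc.2.symm, h4, h4.symm, h5, h5.symm, hne, (hne _).symm])
  rw [NumberField.discr_eq_discr] at hcF
  rw [hm] at hcK
  refine ⟨m, ?_⟩
  push_cast at hcK
  rw [hcK, hcF, Matrix.det_fin_two, Matrix.det_succ_row_zero]
  simp [Fin.sum_univ_succ, Matrix.det_fin_three, Fin.succAbove, hw, hg, hσF]
  ring
end

section
/- Let K be a quartic CM field with real quadratic subfield F, let φ₁, φ₂ : K → ℂ be non-conjugate embeddings, and let γ, δ be algebraic integers of K. Write γ' = γ − γ̄ and δ' = δ − δ̄. Then there exists an integer m such that (Δ_F · (φ₁(γ')·φ₂(δ') + φ₁(δ')·φ₂(γ')))² = m² · Δ_K, as an identity of complex numbers. (Equivalently, φ₁(γ')φ₂(δ') + φ₁(δ')φ₂(γ') lies in (√Δ_K / Δ_F)·ℤ.) -/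
/-- With respect to an enumeration `e` of the complex embeddings of a number field, there is an
integral family whose matrix of embeddings has squared determinant the discriminant, and such that
the determinant attached to any integral family is an integer multiple of it. -/
lemma exists_integral_family_det_embeddings {n : ℕ} (K : Type*) [Field K] [NumberField K]
    (e : Fin n ≃ (K →+* ℂ)) :
    ∃ b : Fin n → K, (∀ i, IsIntegral ℤ (b i)) ∧
      (Matrix.of fun i j => e i (b j)).det ^ 2 = (NumberField.discr K : ℂ) ∧
      ∀ v : Fin n → K, (∀ i, IsIntegral ℤ (v i)) →
        ∃ m : ℤ, (Matrix.of fun i j => e i (v j)).det =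
          m * (Matrix.of fun i j => e i (b j)).det := by
  classical
  have hcard : n = Module.finrank ℚ K := by
    rw [← NumberField.Embeddings.card K ℂ, ← Fintype.card_congr e, Fintype.card_fin]
  let r : Module.Free.ChooseBasisIndex ℤ (NumberField.RingOfIntegers K) ≃ Fin n :=
    Fintype.equivFinOfCardEq (by
      rw [hcard, Module.finrank_eq_card_basis (NumberField.integralBasis K)])
  let b := (NumberField.integralBasis K).reindex r
  refine ⟨b, fun i => ?_, ?_, fun v hv => ?_⟩
  · rw [Module.Basis.reindex_apply, NumberField.integralBasis_apply]
    exact NumberField.RingOfIntegers.isIntegral_coe _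
  · have h := Algebra.discr_eq_det_embeddingsMatrixReindex_pow_two ℚ ℂ b
      (e.trans (RingHom.equivRatAlgHom K ℂ))
    have h2 : Algebra.discr ℚ b = (NumberField.discr K : ℚ) := by
      rw [NumberField.coe_discr, ← Algebra.discr_reindex ℚ _ r]
      simp [b]
    rw [h2, ← Matrix.det_transpose] at h
    exact h.symm.trans (by simp)
  · let A : Matrix (Fin n) (Fin n) ℤ := Matrix.of fun k j =>
      (NumberField.RingOfIntegers.basis K).repr ⟨v j, hv j⟩ (r.symm k)
    refine ⟨A.det, ?_⟩
    have hA : (Matrix.of fun i j => e i (v j)) =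
        (Matrix.of fun i j => e i (b j)) * A.map (Int.castRingHom ℂ) := by
      ext i j
      have hj : v j = ∑ k, (A k j : K) * b k := by
        conv_lhs => rw [← b.sum_repr (v j)]
        refine Finset.sum_congr rfl fun k _ => ?_
        have := NumberField.integralBasis_repr_apply K ⟨v j, hv j⟩ (r.symm k)
        rw [Module.Basis.repr_reindex_apply, Rat.smul_def]
        erw [this]
        simp [A]
      simp only [Matrix.of_apply, Matrix.mul_apply, Matrix.map_apply]
      rw [hj, map_sum]
      exact Finset.sum_congr rfl fun k _ => by simp [mul_comm]
    rw [hA, Matrix.det_mul, ← RingHom.mapMatrix_apply, ← RingHom.map_det]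
    simp [mul_comm]

/-- An injective enumeration of complex embeddings of the right length is a bijection. -/
lemma exists_equiv_embeddings {n : ℕ} (K : Type*) [Field K] [NumberField K]
    (hn : Module.finrank ℚ K = n) (f : Fin n → (K →+* ℂ)) (hf : Function.Injective f) :
    ∃ e : Fin n ≃ (K →+* ℂ), ∀ i, e i = f i :=
  ⟨Equiv.ofBijective f ((Fintype.bijective_iff_injective_and_card f).2
    ⟨hf, by rw [Fintype.card_fin, NumberField.Embeddings.card, hn]⟩), fun _ => rfl⟩

/-- In a quadratic extension, at most two complex embeddings restrict to a given one. -/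
lemma eq_or_eq_of_comp_eq_s7 {K F : Type*} [Field K] [NumberField K] [Field F] [NumberField F]
    (hK4 : Module.finrank ℚ K = 4) (hF2 : Module.finrank ℚ F = 2) (ι : F →+* K)
    {φ₁ φ₂ φ₃ : K →+* ℂ} (h₁₂ : φ₁ ≠ φ₂) (hι : φ₂.comp ι = φ₁.comp ι)
    (hι' : φ₃.comp ι = φ₁.comp ι) : φ₃ = φ₁ ∨ φ₃ = φ₂ := by
  classical
  let := ι.toAlgebra
  let := (φ₁.comp ι).toAlgebra
  have hfin : FiniteDimensional F K := Module.Finite.of_restrictScalars_finite ℚ F K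
  have hd : Module.finrank F K = 2 := by
    have := Module.finrank_mul_finrank ℚ F K
    rw [hK4, hF2] at this
    omega
  have hc : Fintype.card (K →ₐ[F] ℂ) = 2 := by rw [AlgHom.card, hd]
  let g₁ : K →ₐ[F] ℂ := ⟨φ₁, fun _ => rfl⟩
  let g₂ : K →ₐ[F] ℂ := ⟨φ₂, fun x => RingHom.congr_fun hι x⟩
  let g₃ : K →ₐ[F] ℂ := ⟨φ₃, fun x => RingHom.congr_fun hι' x⟩
  by_contra! h
  have h1 : g₃ ≠ g₁ := fun H => h.1 (congrArg AlgHom.toRingHom H)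
  have h2 : g₃ ≠ g₂ := fun H => h.2 (congrArg AlgHom.toRingHom H)
  have h3 : g₁ ≠ g₂ := fun H => h₁₂ (congrArg AlgHom.toRingHom H)
  have := Finset.card_le_univ ({g₃, g₁, g₂} : Finset (K →ₐ[F] ℂ))
  rw [hc, Finset.card_eq_three.2 ⟨_, _, _, h1, h2, h3, rfl⟩] at this
  omega

theorem stmt_7 (K F : Type*) [Field K] [NumberField K] [Field F] [NumberField F]
    (hK4 : Module.finrank ℚ K = 4) (hF2 : Module.finrank ℚ F = 2)
    (hFreal : ∀ (ψ : F →+* ℂ) (x : F), (ψ x).im = 0)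
    (hKim : IsEmpty (K →+* ℝ))
    (ι : F →+* K)
    (σ : K ≃+* K)
    (hσ : ∀ (φ : K →+* ℂ) (x : K), φ (σ x) = starRingEnd ℂ (φ x))
    (hσF : ∀ y : F, σ (ι y) = ι y)
    (φ₁ φ₂ : K →+* ℂ)
    (hnc : φ₂ ≠ φ₁ ∧ φ₂ ≠ (starRingEnd ℂ).comp φ₁)
    (γ δ : K) (hγ : IsIntegral ℤ γ) (hδ : IsIntegral ℤ δ) :
    ∃ m : ℤ, ((NumberField.discr F : ℂ) *
        (φ₁ (γ - σ γ) * φ₂ (δ - σ δ) + φ₁ (δ - σ δ) * φ₂ (γ - σ γ))) ^ 2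
      = (m : ℂ) ^ 2 * (NumberField.discr K : ℂ) := by
  have hnr : ∀ φ : K →+* ℂ, φ ≠ φ.comp σ.toRingHom := fun φ h => by
    have hr : NumberField.ComplexEmbedding.IsReal φ := by
      refine RingHom.ext fun x => ?_
      exact (hσ φ x).symm.trans (RingHom.congr_fun h x).symm
    exact hKim.false hr.embedding
  have hconj : (starRingEnd ℂ).comp φ₁ = φ₁.comp σ.toRingHom :=
    RingHom.ext fun x => (hσ φ₁ x).symm
  have hσσ : ∀ φ : K →+* ℂ, (φ.comp σ.toRingHom).comp σ.toRingHom = φ := fun φ =>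
    RingHom.ext fun x => by simp [hσ]
  obtain ⟨hn1, hn2⟩ := hnc
  rw [hconj] at hn2
  have hF : φ₁.comp ι ≠ φ₂.comp ι := fun h =>
    (eq_or_eq_of_comp_eq_s7 hK4 hF2 ι (hnr φ₁)
      (RingHom.ext fun y => by simp [hσF]) h.symm).elim hn1 hn2
  have hn3 : φ₂.comp σ.toRingHom ≠ φ₁ := fun h => hn2 (by rw [← h, hσσ])
  have hn4 : φ₂.comp σ.toRingHom ≠ φ₁.comp σ.toRingHom := fun h =>
    hn1 (by rw [← hσσ φ₂, h, hσσ])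
  obtain ⟨eF, heF⟩ := exists_equiv_embeddings F hF2 ![φ₁.comp ι, φ₂.comp ι] (by
    intro i j h
    fin_cases i <;> fin_cases j <;> simp_all [hF.symm])
  obtain ⟨eK, heK⟩ := exists_equiv_embeddings K hK4
      ![φ₁, φ₁.comp σ.toRingHom, φ₂, φ₂.comp σ.toRingHom] (by
    have a1 := hnr φ₁
    have a2 := hnr φ₂
    intro i j h
    fin_cases i <;> fin_cases j <;> first | rfl | exact absurd h ‹_› | exact absurd h.symm ‹_›)
  obtain ⟨c, hc, hcd, -⟩ := exists_integral_family_det_embeddings F eF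
  obtain ⟨b, -, hbd, hb⟩ := exists_integral_family_det_embeddings K eK
  set D := (Matrix.of fun i j => eK i (b j)).det
  have hcι : ∀ i, IsIntegral ℤ (ι (c i)) := fun i => map_isIntegral_int ι (hc i)
  have key : ∀ x : K, IsIntegral ℤ x → ∃ m : ℤ,
      (NumberField.discr F : ℂ) * (φ₁ (x - σ x) * φ₂ (x - σ x)) = m * D := by
    intro x hx
    obtain ⟨m, hm⟩ := hb ![ι (c 1), ι (c 0), ι (c 0) * x, ι (c 1) * x] (by
      intro i
      fin_cases i
      exacts [hcι 1, hcι 0, (hcι 0).mul hx, (hcι 1).mul hx])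
    refine ⟨m, hm ▸ ?_⟩
    rw [← hcd, Matrix.det_fin_two, Matrix.det_succ_row_zero]
    simp [Fin.sum_univ_four, Matrix.det_fin_three, heF, heK, Fin.succAbove, hσF]
    ring
  obtain ⟨m₁, h₁⟩ := key (γ + δ) (hγ.add hδ)
  obtain ⟨m₂, h₂⟩ := key γ hγ
  obtain ⟨m₃, h₃⟩ := key δ hδ
  refine ⟨m₁ - m₂ - m₃, ?_⟩
  rw [← hbd, ← mul_pow]
  congr 1
  push_cast
  rw [sub_mul, sub_mul, ← h₁, ← h₂, ← h₃]
  simp only [map_sub, map_add]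
  ring
end

section
/- Let F be a real quadratic number field with discriminant Δ_F and ring of integers O_F, let a, b, c be integers with a ≠ 0 and b² − 4ac = Δ_F, and let ω ∈ O_F satisfy ω² = Δ_F. Then (b + ω)/2 lies in O_F; the ℤ-module I = ℤ·a + ℤ·((b + ω)/2) is an ideal of O_F; and for integers x, y, setting σ = a·x + ((b + ω)/2)·y, one has a·x² + b·x·y + c·y² = ±1 if and only if σ·O_F = I (i.e., σ is a principal generator of the ideal I). -/
open NumberField

/-- Cayley-Hamilton and the discriminant of `1, z` for an element of a rank two algebra. -/
theorem exists_quadratic_relation {R : Type*} [CommRing R] (B : Module.Basis (Fin 2) ℤ R) (z : R) :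
    ∃ t n k : ℤ, z ^ 2 = t * z - n ∧ t ^ 2 - 4 * n = k ^ 2 * Algebra.discr ℤ B := by
  let M := Algebra.leftMulMatrix B z
  have hquad : z ^ 2 = (M.trace : R) * z - (M.det : R) := by
    apply Algebra.leftMulMatrix_injective B
    have hM : M ^ 2 = M.trace • M - M.det • (1 : Matrix (Fin 2) (Fin 2) ℤ) := by
      ext i j
      fin_cases i <;> fin_cases j <;>
        simp [-zsmul_eq_mul, -zsmul_one, pow_two, Matrix.mul_apply, Matrix.trace, Matrix.det_fin_two,
          Fin.sum_univ_two] <;> ring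
    rw [← zsmul_eq_mul, ← zsmul_one M.det, map_sub, map_zsmul, map_zsmul, map_pow, map_one]
    exact hM
  have htr : Algebra.trace ℤ R z = M.trace := Algebra.trace_eq_matrix_trace B z
  have htr1 : Algebra.trace ℤ R 1 = 2 := by
    rw [Algebra.trace_eq_matrix_trace B, map_one]; simp
  have htr2 : Algebra.trace ℤ R (z * z) = M.trace ^ 2 - 2 * M.det := by
    rw [← pow_two, hquad, ← zsmul_eq_mul, ← zsmul_one M.det, map_sub, map_zsmul, map_zsmul, htr,
      htr1, smul_eq_mul, smul_eq_mul]
    ring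
  let P : Matrix (Fin 2) (Fin 2) ℤ := Matrix.of fun i j => B.repr (![1, z] j) i
  have hP : Matrix.vecMul B (P.map (algebraMap ℤ R)) = ![1, z] := by
    ext j
    rw [← B.sum_repr (![1, z] j)]
    simp [Matrix.vecMul, dotProduct, P, Fin.sum_univ_two, mul_comm]
  refine ⟨M.trace, M.det, P.det, hquad, ?_⟩
  rw [← Algebra.discr_of_matrix_vecMul, hP, Algebra.discr_def,
    Matrix.det_fin_two (Algebra.traceMatrix ℤ ![1, z])]
  simp only [Algebra.traceMatrix_apply, Algebra.traceForm_apply, Matrix.cons_val_zero,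
    Matrix.cons_val_one, mul_one, one_mul, htr, htr1, htr2]
  ring

/-- In a domain of rank two over `ℤ` whose discriminant has a square root `ω`, twice any element
lies in `ℤ + ℤ ω`. -/
theorem exists_two_mul_eq {R : Type*} [CommRing R] [IsDomain R] (B : Module.Basis (Fin 2) ℤ R)
    {ω : R} (hω : ω ^ 2 = (Algebra.discr ℤ B : R)) (z : R) :
    ∃ t k n : ℤ, 2 * z = t + k * ω ∧ t ^ 2 - 4 * n = k ^ 2 * Algebra.discr ℤ B := by
  obtain ⟨t, n, k, hz, hd⟩ := exists_quadratic_relation B z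
  have hd' : (t : R) ^ 2 - 4 * n = k ^ 2 * (Algebra.discr ℤ B : R) := by
    simpa using congrArg (Int.cast : ℤ → R) hd
  have hsq : (2 * z - t) ^ 2 = (k * ω) ^ 2 := by
    linear_combination 4 * hz + hd' - (k : R) ^ 2 * hω
  rcases sq_eq_sq_iff_eq_or_eq_neg.mp hsq with h | h
  · exact ⟨t, k, n, by linear_combination h, hd⟩
  · exact ⟨t, -k, n, by push_cast; linear_combination h, by rw [hd]; ring⟩

theorem eq_zero_of_int_add_int_mul_eq_zero {R : Type*} [CommRing R] [IsDomain R] [CharZero R]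
    (B : Module.Basis (Fin 2) ℤ R) {ω : R} (hω : ω ^ 2 = (Algebra.discr ℤ B : R)) {m n : ℤ}
    (h : (m : R) + n * ω = 0) : n = 0 := by
  by_contra hn
  have key (z : R) : ∃ p : ℤ, (2 * n : R) * z = p := by
    obtain ⟨t, k, -, hz, -⟩ := exists_two_mul_eq B hω z
    exact ⟨n * t - k * m, by push_cast; linear_combination (n : R) * hz + (k : R) * h⟩
  obtain ⟨p, hp⟩ := key (B 0)
  obtain ⟨q, hq⟩ := key (B 1)
  have hli := Fintype.linearIndependent_iff.mp B.linearIndependent ![q, -p] (by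
    have h2n : (2 * n : R) ≠ 0 := by exact_mod_cast mul_ne_zero two_ne_zero hn
    apply mul_left_cancel₀ h2n
    simp only [Fin.sum_univ_two, Matrix.cons_val_zero, Matrix.cons_val_one, zsmul_eq_mul]
    push_cast
    linear_combination (q : R) * hp - (p : R) * hq)
  have hp0 : p = 0 := by simpa using hli 1
  have h2n : (2 * n : R) ≠ 0 := by exact_mod_cast mul_ne_zero two_ne_zero hn
  rw [hp0, Int.cast_zero] at hp
  exact B.ne_zero 0 ((mul_eq_zero.mp hp).resolve_left h2n)

theorem exists_eq_int_add_int_mul {R : Type*} [CommRing R] [IsDomain R] [CharZero R]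
    (B : Module.Basis (Fin 2) ℤ R) {ω τ : R} (hω : ω ^ 2 = (Algebra.discr ℤ B : R)) {b e : ℤ}
    (hdisc : b ^ 2 - 4 * e = Algebra.discr ℤ B) (hτ : 2 * τ = b + ω) (z : R) :
    ∃ p q : ℤ, z = p + q * τ := by
  obtain ⟨t, k, n, hz, hd⟩ := exists_two_mul_eq B hω z
  have hev : Even (t - k * b) := by
    have hsq : Even ((t - k * b) ^ 2) :=
      ⟨2 * n - 2 * k ^ 2 * e + k ^ 2 * b ^ 2 - t * k * b, by
        rw [← hdisc] at hd; linear_combination hd⟩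
    exact (Int.even_pow.mp hsq).1
  obtain ⟨p, hp⟩ := hev
  have hp' : (t : R) - k * b = p + p := by exact_mod_cast hp
  refine ⟨p, k, mul_left_cancel₀ (two_ne_zero (α := R)) ?_⟩
  linear_combination hz + hp' - (k : R) * hτ

/-- If `R = ℤ + ℤ τ` with `1, τ` independent and `τ² = b τ - a c`, then `ℤ a + ℤ τ` is an ideal,
generated by `a x + τ y` exactly when the form `(a, b, c)` represents `±1` at `(x, y)`. -/
theorem exists_ideal_span_singleton_eq_iff {R : Type*} [CommRing R] {a b c : ℤ} (ha : a ≠ 0)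
    {τ : R} (hτ : τ ^ 2 = b * τ - a * c) (hgen : ∀ z : R, ∃ p q : ℤ, z = p + q * τ)
    (hind : ∀ m n : ℤ, (m : R) + n * τ = 0 → m = 0 ∧ n = 0) :
    ∃ J : Ideal R, (J : Set R) = (Submodule.span ℤ ({(a : R), τ} : Set R) : Set R) ∧
      ∀ x y : ℤ,
        (a * x ^ 2 + b * x * y + c * y ^ 2 = 1 ∨ a * x ^ 2 + b * x * y + c * y ^ 2 = -1) ↔
          Ideal.span {(a : R) * (x : R) + τ * (y : R)} = J := by
  have hmem (z : R) : z ∈ Submodule.span ℤ ({(a : R), τ} : Set R) ↔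
      ∃ m n : ℤ, (m : R) * a + n * τ = z := by
    simp [Submodule.mem_span_pair]
  let J : Ideal R :=
    { (Submodule.span ℤ ({(a : R), τ} : Set R)).toAddSubmonoid with
      smul_mem' := by
        intro r z hz
        obtain ⟨m, n, rfl⟩ := (hmem z).mp hz
        obtain ⟨p, q, rfl⟩ := hgen r
        refine (hmem _).mpr ⟨p * m - q * n * c, p * n + q * m * a + q * n * b, ?_⟩
        push_cast
        rw [smul_eq_mul]
        linear_combination -((q : R) * n) * hτ }
  have hJ (z : R) : z ∈ J ↔ ∃ m n : ℤ, (m : R) * a + n * τ = z := hmem z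
  refine ⟨J, rfl, fun x y => ⟨fun hf => ?_, fun hspan => ?_⟩⟩
  · have hunit : IsUnit ((a * x ^ 2 + b * x * y + c * y ^ 2 : ℤ) : R) :=
      (Int.isUnit_iff.mpr hf).map (Int.castRingHom R)
    apply le_antisymm
    · rw [Ideal.span_singleton_le_iff_mem, hJ]
      exact ⟨x, y, by ring⟩
    · have hamem : (a : R) ∈ Ideal.span {(a : R) * x + τ * y} := by
        rw [← Ideal.unit_mul_mem_iff_mem _ hunit, Ideal.mem_span_singleton]
        refine ⟨a * x + b * y - y * τ, ?_⟩
        push_cast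
        linear_combination (y : R) ^ 2 * hτ
      have hτmem : τ ∈ Ideal.span {(a : R) * x + τ * y} := by
        rw [← Ideal.unit_mul_mem_iff_mem _ hunit, Ideal.mem_span_singleton]
        refine ⟨c * y + x * τ, ?_⟩
        push_cast
        linear_combination -((x : R) * y) * hτ
      intro z hz
      obtain ⟨m, n, rfl⟩ := (hJ z).mp hz
      exact add_mem (Ideal.mul_mem_left _ _ hamem) (Ideal.mul_mem_left _ _ hτmem)
  · have hamem : (a : R) ∈ Ideal.span {(a : R) * x + τ * y} := by
      rw [hspan, hJ]; exact ⟨1, 0, by simp⟩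
    have hτmem : τ ∈ Ideal.span {(a : R) * x + τ * y} := by
      rw [hspan, hJ]; exact ⟨0, 1, by simp⟩
    obtain ⟨u, hu⟩ := Ideal.mem_span_singleton.mp hamem
    obtain ⟨v, hv⟩ := Ideal.mem_span_singleton.mp hτmem
    obtain ⟨p, q, rfl⟩ := hgen u
    obtain ⟨r, s, rfl⟩ := hgen v
    obtain ⟨h1, h2⟩ := hind (a * (p * x - q * c * y - 1)) (p * y + q * (a * x + b * y)) (by
      push_cast; linear_combination -hu - (q : R) * y * hτ)
    obtain ⟨h3, h4⟩ := hind (a * (r * x - s * c * y)) (r * y + s * (a * x + b * y) - 1) (by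
      push_cast; linear_combination -hv - (s : R) * y * hτ)
    replace h1 := (mul_eq_zero.mp h1).resolve_left ha
    replace h3 := (mul_eq_zero.mp h3).resolve_left ha
    apply Int.isUnit_iff.mp
    refine IsUnit.of_mul_eq_one (p * s - q * r) ?_
    linear_combination (r * y + s * (a * x + b * y)) * h1 + h4
      - (p * y + q * (a * x + b * y)) * h3

theorem stmt_10 (F : Type*) [Field F] [NumberField F]
    (hF2 : Module.finrank ℚ F = 2)
    (hFreal : ∀ (ψ : F →+* ℂ) (x : F), (ψ x).im = 0)
    (a b c : ℤ) (ha : a ≠ 0) (hdisc : b ^ 2 - 4 * a * c = NumberField.discr F)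
    (ω : 𝓞 F) (hω : ω ^ 2 = (NumberField.discr F : 𝓞 F)) :
    ∃ τ : 𝓞 F, 2 * τ = (b : 𝓞 F) + ω ∧
      ∃ J : Ideal (𝓞 F),
        (J : Set (𝓞 F)) = (Submodule.span ℤ ({(a : 𝓞 F), τ} : Set (𝓞 F)) : Set (𝓞 F)) ∧
        ∀ x y : ℤ,
          (a * x ^ 2 + b * x * y + c * y ^ 2 = 1 ∨ a * x ^ 2 + b * x * y + c * y ^ 2 = -1) ↔
            Ideal.span {(a : 𝓞 F) * (x : 𝓞 F) + τ * (y : 𝓞 F)} = J := by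
  let B : Module.Basis (Fin 2) ℤ (𝓞 F) :=
    Module.finBasisOfFinrankEq ℤ (𝓞 F) ((RingOfIntegers.rank F).trans hF2)
  have hB : Algebra.discr ℤ B = NumberField.discr F := NumberField.discr_eq_discr F B
  rw [← hB] at hω hdisc
  have hdisc' : (b : 𝓞 F) ^ 2 - 4 * a * c = (Algebra.discr ℤ B : 𝓞 F) := by exact_mod_cast hdisc
  obtain ⟨τ, hτ⟩ : ∃ τ : 𝓞 F, 2 * τ = (b : 𝓞 F) + ω := by
    have hω' : (ω : F) ^ 2 = (b : F) ^ 2 - 4 * a * c := by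
      have h := congrArg (algebraMap (𝓞 F) F) (hω.trans hdisc'.symm)
      rwa [map_pow, map_sub, map_mul, map_mul, map_pow, map_ofNat, map_intCast, map_intCast,
        map_intCast] at h
    have hint : IsIntegral ℤ (((b : F) + ω) / 2) := by
      refine ⟨Polynomial.X ^ 2 - Polynomial.C b * Polynomial.X + Polynomial.C (a * c),
        by monicity!, ?_⟩
      rw [Polynomial.eval₂_add, Polynomial.eval₂_sub, Polynomial.eval₂_mul, Polynomial.eval₂_X_pow,
        Polynomial.eval₂_X, Polynomial.eval₂_C, Polynomial.eval₂_C, eq_intCast, eq_intCast,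
        Int.cast_mul]
      linear_combination hω' / 4
    obtain ⟨τ, hτ⟩ : ∃ τ : 𝓞 F, algebraMap (𝓞 F) F τ = (b + ω) / 2 := ⟨⟨_, hint⟩, rfl⟩
    refine ⟨τ, RingOfIntegers.coe_injective ?_⟩
    rw [map_mul, map_add, map_ofNat, map_intCast, hτ]
    ring
  have hquad : τ ^ 2 = b * τ - a * c := by
    apply mul_left_cancel₀ (show (4 : 𝓞 F) ≠ 0 by norm_num)
    linear_combination (2 * τ + ω - b) * hτ + hω - hdisc'
  refine ⟨τ, hτ, exists_ideal_span_singleton_eq_iff ha hquad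
    (exists_eq_int_add_int_mul B hω (e := a * c) (by rw [← hdisc]; ring) hτ) fun m n h => ?_⟩
  have hn : n = 0 := eq_zero_of_int_add_int_mul_eq_zero B hω (m := 2 * m + n * b) (by
    push_cast; linear_combination 2 * h - (n : 𝓞 F) * hτ)
  subst hn
  exact ⟨by simpa using h, rfl⟩
end

section
/- Let K be a quartic CM field, let φ₁, φ₂ : K → ℂ be non-conjugate embeddings, and let γ be an algebraic integer of K. Then the discriminant of the 4-tuple (1, γ, γ̄, γ²) over ℚ satisfies, as an identity of complex numbers, disc(1, γ, γ̄, γ²) = (φ₁(γ + γ̄) − φ₂(γ + γ̄))⁴ · (φ₁(γ − γ̄)·φ₂(γ − γ̄))². -/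
open NumberField in
theorem conjugate_ne_self_of_isEmpty_real {K : Type*} [Field K] (hK : IsEmpty (K →+* ℝ))
    (φ : K →+* ℂ) : (starRingEnd ℂ).comp φ ≠ φ := fun h =>
  hK.false (ComplexEmbedding.IsReal.embedding (φ := φ) h)

/-- The discriminant is the squared determinant of the conjugates, for an exhaustive injective
family of complex embeddings. -/
theorem discr_eq_det_sq_of_injective {K ι : Type*} [Field K] [NumberField K] [Fintype ι]
    [DecidableEq ι] (hK : Module.finrank ℚ K = Fintype.card ι) (b : ι → K)
    (v : ι → K →+* ℂ) (hv : Function.Injective v) :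
    ((Algebra.discr ℚ b : ℚ) : ℂ) = (Matrix.of fun i j => v j (b i)).det ^ 2 := by
  have hw : Function.Bijective fun i => (v i).toRatAlgHom := by
    rw [Fintype.bijective_iff_injective_and_card]
    refine ⟨fun i j h => hv ?_, ?_⟩
    · ext x
      exact DFunLike.congr_fun h x
    · rw [← hK, AlgHom.card]
  exact Algebra.discr_eq_det_embeddingsMatrixReindex_pow_two ℚ ℂ b (Equiv.ofBijective _ hw)

theorem stmt_14 (K F : Type*) [Field K] [NumberField K] [Field F] [NumberField F]
    (hK4 : Module.finrank ℚ K = 4) (hF2 : Module.finrank ℚ F = 2)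
    (hFreal : ∀ (ψ : F →+* ℂ) (x : F), (ψ x).im = 0)
    (hKim : IsEmpty (K →+* ℝ))
    (ι : F →+* K)
    (σ : K ≃+* K)
    (hσ : ∀ (φ : K →+* ℂ) (x : K), φ (σ x) = starRingEnd ℂ (φ x))
    (hσF : ∀ y : F, σ (ι y) = ι y)
    (φ₁ φ₂ : K →+* ℂ)
    (hnc : φ₂ ≠ φ₁ ∧ φ₂ ≠ (starRingEnd ℂ).comp φ₁)
    (γ : K) (hγ : IsIntegral ℤ γ) :
    ((Algebra.discr ℚ ![1, γ, σ γ, γ ^ 2] : ℚ) : ℂ)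
      = (φ₁ (γ + σ γ) - φ₂ (γ + σ γ)) ^ 4 * (φ₁ (γ - σ γ) * φ₂ (γ - σ γ)) ^ 2 := by
  obtain ⟨h₁, h₂⟩ := hnc
  have hr₁ := conjugate_ne_self_of_isEmpty_real hKim φ₁
  have hr₂ := conjugate_ne_self_of_isEmpty_real hKim φ₂
  have hinv (φ : K →+* ℂ) : (starRingEnd ℂ).comp ((starRingEnd ℂ).comp φ) = φ := by
    ext x
    simp
  have h₃ : (starRingEnd ℂ).comp φ₂ ≠ φ₁ := fun h => h₂ (by rw [← h, hinv])
  have h₄ : (starRingEnd ℂ).comp φ₂ ≠ (starRingEnd ℂ).comp φ₁ := fun h =>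
    h₁ (by rw [← hinv φ₂, h, hinv])
  have hv : Function.Injective
      ![φ₁, (starRingEnd ℂ).comp φ₁, φ₂, (starRingEnd ℂ).comp φ₂] := by
    intro i j hij
    fin_cases i <;> fin_cases j <;> first | rfl | exact absurd hij ‹_› | exact absurd hij.symm ‹_›
  rw [discr_eq_det_sq_of_injective (by simpa using hK4) _ _ hv]
  simp [Matrix.det_succ_row_zero, Fin.sum_univ_succ, Fin.succAbove, hσ]
  ring
end

section
/- Let F be a real quadratic number field with distinct real embeddings φ₁, φ₂ : F → ℝ, let ε be a unit of the ring of integers O_F, let γ be a nonzero element of O_F, and let i be an integer. Then max(|φ₁(γ·εⁱ)|, |φ₂(γ·εⁱ)|) ≥ min(|φ₁(γ)|, |φ₂(γ)|) · max(|φ₁(ε)|, |φ₂(ε)|)^{|i|}. -/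
open NumberField

/-- In a quadratic number field with two distinct real embeddings, the norm is their product. -/
theorem norm_eq_mul_of_finrank_eq_two {F : Type*} [Field F] [NumberField F]
    (hF2 : Module.finrank ℚ F = 2) {φ₁ φ₂ : F →+* ℝ} (hne : φ₁ ≠ φ₂) (x : F) :
    (Algebra.norm ℚ x : ℝ) = φ₁ x * φ₂ x := by
  classical
  let ψ₁ : F →ₐ[ℚ] ℂ := (Complex.ofRealHom.comp φ₁).toRatAlgHom
  let ψ₂ : F →ₐ[ℚ] ℂ := (Complex.ofRealHom.comp φ₂).toRatAlgHom
  have hψ : ψ₁ ≠ ψ₂ := fun h => hne <| RingHom.ext fun y =>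
    Complex.ofReal_injective (DFunLike.congr_fun h y)
  have huniv : ({ψ₁, ψ₂} : Finset (F →ₐ[ℚ] ℂ)) = Finset.univ := by
    rw [← Finset.card_eq_iff_eq_univ, Finset.card_pair hψ, AlgHom.card, hF2]
  have hprod := Algebra.norm_eq_prod_embeddings ℚ ℂ x
  rw [← huniv, Finset.prod_pair hψ] at hprod
  apply Complex.ofReal_injective
  simpa [ψ₁, ψ₂] using hprod

theorem abs_mul_abs_eq_one_of_unit {F : Type*} [Field F] [NumberField F]
    (hF2 : Module.finrank ℚ F = 2) {φ₁ φ₂ : F →+* ℝ} (hne : φ₁ ≠ φ₂) (ε : (𝓞 F)ˣ) :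
    |φ₁ ((ε : 𝓞 F) : F)| * |φ₂ ((ε : 𝓞 F) : F)| = 1 := by
  have h := NumberField.isUnit_iff_norm.mp ε.isUnit
  rw [RingOfIntegers.coe_norm] at h
  rw [← abs_mul, ← norm_eq_mul_of_finrank_eq_two hF2 hne]
  exact_mod_cast h

theorem max_pow_natAbs_le_max_zpow {a b : ℝ} (hab : a * b = 1) (i : ℤ) :
    max a b ^ i.natAbs ≤ max (a ^ i) (b ^ i) := by
  have hpow (n : ℕ) : max a b ^ n ≤ max (a ^ n) (b ^ n) := by
    rcases max_choice a b with h | h <;> simp [h]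
  rcases Int.natAbs_eq i with h | h
  · rw [h, zpow_natCast, zpow_natCast]
    exact hpow _
  · rw [h, zpow_neg, zpow_neg, zpow_natCast, zpow_natCast, ← inv_pow, ← inv_pow,
      inv_eq_of_mul_eq_one_right hab, inv_eq_of_mul_eq_one_left hab, max_comm (b ^ _),
      Int.natAbs_neg]
    exact hpow _

theorem stmt_16 (F : Type*) [Field F] [NumberField F]
    (hF2 : Module.finrank ℚ F = 2)
    (φ₁ φ₂ : F →+* ℝ) (hne : φ₁ ≠ φ₂)
    (ε : (𝓞 F)ˣ) (γ : 𝓞 F) (hγ : γ ≠ 0) (i : ℤ) :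
    min |φ₁ (γ : F)| |φ₂ (γ : F)|
        * max |φ₁ ((ε : 𝓞 F) : F)| |φ₂ ((ε : 𝓞 F) : F)| ^ i.natAbs
      ≤ max |φ₁ ((γ * ((ε ^ i : (𝓞 F)ˣ) : 𝓞 F) : 𝓞 F) : F)|
          |φ₂ ((γ * ((ε ^ i : (𝓞 F)ˣ) : 𝓞 F) : 𝓞 F) : F)| := by
  have hmin : 0 ≤ min |φ₁ (γ : F)| |φ₂ (γ : F)| := le_min (abs_nonneg _) (abs_nonneg _)
  refine (mul_le_mul_of_nonneg_left (max_pow_natAbs_le_max_zpow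
    (abs_mul_abs_eq_one_of_unit hF2 hne ε) i) hmin).trans ?_
  rw [mul_max_of_nonneg _ _ hmin]
  simp only [map_mul, abs_mul, NumberField.Units.coe_zpow, map_zpow₀, abs_zpow]
  gcongr
  · exact min_le_left _ _
  · exact min_le_right _ _
end

section
/- Let a, b, c, x, y be integers with a ≠ 0 and y ≠ 0, let Δ = b² − 4ac, and suppose Δ > 0 and a·x² + b·x·y + c·y² = ±1. Then |x| ≤ ((|b| + √(Δ + 4|a|)) / (2|a|)) · |y|. -/
theorem stmt_17 (a b c x y : ℤ) (ha : a ≠ 0) (hy : y ≠ 0)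
    (hΔ : 0 < b ^ 2 - 4 * a * c)
    (hsol : a * x ^ 2 + b * x * y + c * y ^ 2 = 1 ∨ a * x ^ 2 + b * x * y + c * y ^ 2 = -1) :
    ((|x| : ℤ) : ℝ)
      ≤ (((|b| : ℤ) : ℝ) + Real.sqrt (((b ^ 2 - 4 * a * c : ℤ) : ℝ) + 4 * ((|a| : ℤ) : ℝ)))
          / (2 * ((|a| : ℤ) : ℝ)) * ((|y| : ℤ) : ℝ) := by
  have key : (2 * a * x + b * y) ^ 2 ≤ (b ^ 2 - 4 * a * c + 4 * |a|) * y ^ 2 := by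
    have hy1 : 1 ≤ y ^ 2 := (one_le_sq_iff_one_le_abs y).mpr (Int.one_le_abs hy)
    have h1 : |a| ≤ |a| * y ^ 2 := le_mul_of_one_le_right (abs_nonneg a) hy1
    rcases hsol with h | h
    · linear_combination 4 * a * h + 4 * h1 + 4 * le_abs_self a
    · linear_combination 4 * a * h + 4 * h1 + 4 * neg_le_abs a
  have hkey : (2 * a * x + b * y : ℝ) ^ 2
      ≤ (((b ^ 2 - 4 * a * c : ℤ) : ℝ) + 4 * ((|a| : ℤ) : ℝ)) * (y : ℝ) ^ 2 := by
    exact_mod_cast key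
  have hroot := Real.abs_le_sqrt hkey
  rw [Real.sqrt_mul' _ (sq_nonneg _), Real.sqrt_sq_eq_abs] at hroot
  have ha' : 0 < |(a : ℝ)| := abs_pos.mpr (Int.cast_ne_zero.mpr ha)
  have htri : 2 * |(a : ℝ)| * |(x : ℝ)| ≤ |(2 * a * x + b * y : ℝ)| + |(b : ℝ)| * |(y : ℝ)| := by
    have h := abs_sub (2 * a * x + b * y : ℝ) (b * y)
    rwa [add_sub_cancel_right, abs_mul, abs_mul, abs_mul, abs_two] at h
  simp only [Int.cast_abs] at hroot ⊢
  rw [div_mul_eq_mul_div, le_div_iff₀ (by positivity)]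
  linarith
end
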